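/- arXiv:2304.04736 — 6 statements merged into one kernel-verified Lean document; each statement's English description precedes it below -/
import Mathlib

section
/- Let S be a measurable space, let m and h be probability measures on S, let μ = m + h, and let f = dm/dμ and g = dh/dμ be Radon–Nikodym derivatives of m and h with respect to μ. Define A* = {s ∈ S : f(s) ≥ g(s)}. Then m((A*)ᶜ) + h(A*) = 1 − TV(m, h); that is, the likelihood-ratio-based detector with acceptance region A* achieves the minimal sum of Type-I and Type-II error probabilities 1 − TV(m, h). -/
open MeasureTheory

/-- Total variation distance: supremum over measurable sets of the difference of measures. -/
noncomputable def TVdist {S : Type*} [MeasurableSpace S]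
    (m h : Measure S) : ℝ :=
  ⨆ B : {B : Set S // MeasurableSet B}, ((m B.1).toReal - (h B.1).toReal)

/-- A set on which one density dominates another carries at least as much of its measure. -/
theorem measure_le_of_rnDeriv_le {S : Type*} [MeasurableSpace S] {m h μ : Measure S}
    [SigmaFinite m] [SigmaFinite h] [SigmaFinite μ] (hm : m ≪ μ) (hh : h ≪ μ) {E : Set S}
    (hE : MeasurableSet E) (hle : ∀ s ∈ E, h.rnDeriv μ s ≤ m.rnDeriv μ s) : h E ≤ m E := by
  rw [← Measure.setLIntegral_rnDeriv hh E, ← Measure.setLIntegral_rnDeriv hm E]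
  exact setLIntegral_mono' hE hle

/-- The region where the density of `m` dominates that of `h` maximizes `m B - h B`. -/
theorem measureReal_sub_le_of_rnDeriv {S : Type*} [MeasurableSpace S] {m h μ : Measure S}
    [IsFiniteMeasure m] [IsFiniteMeasure h] [SigmaFinite μ] (hm : m ≪ μ) (hh : h ≪ μ)
    {B : Set S} (hB : MeasurableSet B) :
    m.real B - h.real B ≤ m.real {s | h.rnDeriv μ s ≤ m.rnDeriv μ s}
      - h.real {s | h.rnDeriv μ s ≤ m.rnDeriv μ s} := by
  set A := {s | h.rnDeriv μ s ≤ m.rnDeriv μ s}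
  have hA : MeasurableSet A :=
    measurableSet_le (Measure.measurable_rnDeriv h μ) (Measure.measurable_rnDeriv m μ)
  have hAB : h.real (A \ B) ≤ m.real (A \ B) :=
    ENNReal.toReal_mono (measure_ne_top _ _)
      (measure_le_of_rnDeriv_le hm hh (hA.diff hB) fun s hs => hs.1)
  have hBA : m.real (B \ A) ≤ h.real (B \ A) :=
    ENNReal.toReal_mono (measure_ne_top _ _)
      (measure_le_of_rnDeriv_le hh hm (hB.diff hA) fun s hs => (not_le.mp hs.2).le)
  have hmA := measureReal_inter_add_sdiff (μ := m) (s := A) hB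
  have hhA := measureReal_inter_add_sdiff (μ := h) (s := A) hB
  have hmB := measureReal_inter_add_sdiff (μ := m) (s := B) hA
  have hhB := measureReal_inter_add_sdiff (μ := h) (s := B) hA
  rw [Set.inter_comm] at hmB hhB
  linarith

/-- The likelihood-ratio-based detector with acceptance region
`A* = {s | dm/dμ s ≥ dh/dμ s}` (with `μ = m + h`) achieves the minimal sum of
Type-I and Type-II error probabilities, namely `1 - TV(m, h)`. -/
theorem likelihood_ratio_detector_optimal {S : Type*} [MeasurableSpace S]
    (m h : Measure S) [IsProbabilityMeasure m] [IsProbabilityMeasure h] :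
    (m {s | h.rnDeriv (m + h) s ≤ m.rnDeriv (m + h) s}ᶜ).toReal
      + (h {s | h.rnDeriv (m + h) s ≤ m.rnDeriv (m + h) s}).toReal
      = 1 - TVdist m h := by
  set A := {s | h.rnDeriv (m + h) s ≤ m.rnDeriv (m + h) s}
  have hA : MeasurableSet A :=
    measurableSet_le (Measure.measurable_rnDeriv h _) (Measure.measurable_rnDeriv m _)
  have hm : m ≪ m + h := Measure.absolutelyContinuous_of_le (Measure.le_add_right le_rfl)
  have hh : h ≪ m + h := Measure.absolutelyContinuous_of_le (Measure.le_add_left le_rfl)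
  have hTV : TVdist m h = m.real A - h.real A := by
    have hle : ∀ B : {B : Set S // MeasurableSet B},
        m.real B.1 - h.real B.1 ≤ m.real A - h.real A :=
      fun B => measureReal_sub_le_of_rnDeriv hm hh B.2
    have : Nonempty {B : Set S // MeasurableSet B} := ⟨⟨A, hA⟩⟩
    exact le_antisymm (ciSup_le hle)
      (le_ciSup (f := fun B : {B : Set S // MeasurableSet B} => m.real B.1 - h.real B.1)
        ⟨_, Set.forall_mem_range.mpr hle⟩ ⟨A, hA⟩)
  change m.real Aᶜ + h.real A = _
  rw [hTV, probReal_compl_eq_one_sub hA]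
  ring
end

section
/- Let S be a measurable space, let m and h be probability measures on S, and set δ = TV(m, h). Then for every natural number n, the total variation distance between the n-fold product measures satisfies TV(m^⊗n, h^⊗n) ≥ 1 − 2·exp(−n·δ²/2). -/
open MeasureTheory

lemma bddAbove_range_measure_sub {S : Type*} [MeasurableSpace S]
    (m h : Measure S) [IsProbabilityMeasure m] :
    BddAbove (Set.range fun B : {B : Set S // MeasurableSet B} =>
      (m B.1).toReal - (h B.1).toReal) := by
  refine ⟨1, ?_⟩
  rintro _ ⟨B, rfl⟩
  have h1 : m.real B.1 ≤ 1 := measureReal_le_one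
  have h2 : 0 ≤ h.real B.1 := measureReal_nonneg
  simp only [Measure.real] at h1 h2
  linarith

/-- **Hoeffding's inequality** for the product measure and a function with range of length one. -/
lemma measureReal_pi_sum_sub_integral_ge_le {S : Type*} [MeasurableSpace S]
    (m : Measure S) [IsProbabilityMeasure m] (n : ℕ) {X : S → ℝ} (hX : Measurable X) {a : ℝ}
    (ha : ∀ s, X s ∈ Set.Icc a (a + 1)) {t : ℝ} (ht : 0 ≤ t) :
    (Measure.pi fun _ : Fin n => m).real {ω | n * t ≤ ∑ i, (X (ω i) - ∫ s, X s ∂m)}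
      ≤ Real.exp (-(2 * n * t ^ 2)) := by
  have hsub : ∀ i ∈ (Finset.univ : Finset (Fin n)),
      ProbabilityTheory.HasSubgaussianMGF (fun ω : Fin n → S => X (ω i) - ∫ s, X s ∂m)
        ((‖a + 1 - a‖₊ / 2) ^ 2) (Measure.pi fun _ : Fin n => m) := by
    intro i _
    refine ProbabilityTheory.HasSubgaussianMGF.of_map (Y := fun ω : Fin n → S => ω i)
      (X := fun s => X s - ∫ s, X s ∂m) (measurable_pi_apply i).aemeasurable ?_
    rw [(measurePreserving_eval (fun _ : Fin n => m) i).map_eq]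
    exact ProbabilityTheory.hasSubgaussianMGF_of_mem_Icc hX.aemeasurable (ae_of_all _ ha)
  have hindep : ProbabilityTheory.iIndepFun
      (fun (i : Fin n) (ω : Fin n → S) => X (ω i) - ∫ s, X s ∂m) (Measure.pi fun _ => m) :=
    ProbabilityTheory.iIndepFun_pi (X := fun _ s => X s - ∫ s, X s ∂m)
      fun _ => (hX.sub_const _).aemeasurable
  refine (ProbabilityTheory.HasSubgaussianMGF.measure_sum_ge_le_of_iIndepFun hindep hsub
    (by positivity : 0 ≤ n * t)).trans_eq ?_
  congr 1
  rcases Nat.eq_zero_or_pos n with rfl | hn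
  · simp
  · have : (n : ℝ) ≠ 0 := by positivity
    simp
    field_simp

lemma TVdist_pi_ge_of_measurableSet {S : Type*} [MeasurableSpace S]
    (m h : Measure S) [IsProbabilityMeasure m] [IsProbabilityMeasure h] (n : ℕ)
    {B : Set S} (hB : MeasurableSet B) (hle : h.real B ≤ m.real B) :
    1 - 2 * Real.exp (-(n : ℝ) * (m.real B - h.real B) ^ 2 / 2)
      ≤ TVdist (Measure.pi fun _ : Fin n => m) (Measure.pi fun _ : Fin n => h) := by
  set f : S → ℝ := B.indicator 1 with hf
  have hfm : Measurable f := measurable_one.indicator hB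
  have hf0 : ∀ s, 0 ≤ f s := Set.indicator_nonneg fun _ _ => zero_le_one
  have hf1 : ∀ s, f s ≤ 1 := Set.indicator_le_self' fun _ _ => zero_le_one
  set A : Set (Fin n → S) := {ω | n * ((m.real B + h.real B) / 2) ≤ ∑ i, f (ω i)} with hA
  have hAm : MeasurableSet A := measurableSet_le measurable_const (by fun_prop)
  have ht : 0 ≤ (m.real B - h.real B) / 2 := by linarith
  have hexp : -(2 * n * ((m.real B - h.real B) / 2) ^ 2)
      = -(n : ℝ) * (m.real B - h.real B) ^ 2 / 2 := by ring
  have upper := measureReal_pi_sum_sub_integral_ge_le h n hfm (a := 0)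
    (fun s => ⟨hf0 s, by simpa using hf1 s⟩) ht
  have lower := measureReal_pi_sum_sub_integral_ge_le m n hfm.neg (a := -1)
    (fun s => ⟨neg_le_neg (hf1 s), by simpa using hf0 s⟩) ht
  rw [hexp] at upper lower
  have hAh : (Measure.pi fun _ : Fin n => h).real A
      ≤ Real.exp (-(n : ℝ) * (m.real B - h.real B) ^ 2 / 2) := by
    refine le_trans (measureReal_mono fun ω hω => ?_) upper
    simp only [hA, Set.mem_ofPred_eq, hf, integral_indicator_one hB, Finset.sum_sub_distrib,
      Finset.sum_const, Finset.card_univ, Fintype.card_fin, nsmul_eq_mul] at hω ⊢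
    linarith
  have hAc : (Measure.pi fun _ : Fin n => m).real Aᶜ
      ≤ Real.exp (-(n : ℝ) * (m.real B - h.real B) ^ 2 / 2) := by
    refine le_trans (measureReal_mono fun ω hω => ?_) lower
    simp only [hA, Set.mem_compl_iff, Set.mem_ofPred_eq, not_le, hf, Pi.neg_apply, integral_neg,
      integral_indicator_one hB, Finset.sum_sub_distrib, Finset.sum_neg_distrib,
      Finset.sum_const, Finset.card_univ, Fintype.card_fin, nsmul_eq_mul] at hω ⊢
    linarith
  rw [probReal_compl_eq_one_sub hAm] at hAc
  have hsup := le_ciSup (bddAbove_range_measure_sub (Measure.pi fun _ : Fin n => m)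
    (Measure.pi fun _ : Fin n => h)) ⟨A, hAm⟩
  change (Measure.pi fun _ : Fin n => m).real A - (Measure.pi fun _ : Fin n => h).real A
    ≤ TVdist _ _ at hsup
  linarith

/-- With `δ = TV(m, h)`, the total variation between the `n`-fold product measures
satisfies `TV(m^⊗n, h^⊗n) ≥ 1 − 2·exp(−n·δ²/2)`. -/
theorem tv_product_lower_bound {S : Type*} [MeasurableSpace S]
    (m h : Measure S) [IsProbabilityMeasure m] [IsProbabilityMeasure h] (n : ℕ) :
    TVdist (Measure.pi fun _ : Fin n => m) (Measure.pi fun _ : Fin n => h)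
      ≥ 1 - 2 * Real.exp (-(n : ℝ) * (TVdist m h) ^ 2 / 2) := by
  have hclosed : IsClosed {x : ℝ | 1 - 2 * Real.exp (-(n : ℝ) * x ^ 2 / 2)
      ≤ TVdist (Measure.pi fun _ : Fin n => m) (Measure.pi fun _ : Fin n => h)} :=
    isClosed_le (by fun_prop) continuous_const
  refine closure_minimal ?_ hclosed (csSup_mem_closure
    ⟨_, ⟨⟨∅, MeasurableSet.empty⟩, rfl⟩⟩ (bddAbove_range_measure_sub m h))
  rintro _ ⟨⟨B, hB⟩, rfl⟩
  change 1 - 2 * Real.exp (-(n : ℝ) * (m.real B - h.real B) ^ 2 / 2) ≤ _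
  rcases le_total (h.real B) (m.real B) with hle | hle
  · exact TVdist_pi_ge_of_measurableSet m h n hB hle
  · have := TVdist_pi_ge_of_measurableSet m h n hB.compl (by
      rw [probReal_compl_eq_one_sub hB, probReal_compl_eq_one_sub hB]; linarith)
    rwa [probReal_compl_eq_one_sub hB, probReal_compl_eq_one_sub hB, sub_sub_sub_cancel_left,
      sub_sq_comm] at this
end

section
/- Let S be a measurable space and let m and h be probability measures on S with m ≠ h. Then the sequence n ↦ TV(m^⊗n, h^⊗n) converges to 1 as n → ∞; in other words, as more i.i.d. samples are collected, the total variation distance between the machine and human product distributions tends to 1. -/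
open MeasureTheory Filter

/-- Chebyshev's inequality for the number of samples falling in `A`, among `n` independent samples
of law `μ`. -/
lemma measureReal_pi_abs_sum_indicator_sub_ge_le {S : Type*} [MeasurableSpace S]
    (μ : Measure S) [IsProbabilityMeasure μ] {A : Set S} (hA : MeasurableSet A)
    {n : ℕ} (hn : 0 < n) {δ : ℝ} (hδ : 0 < δ) :
    (Measure.pi fun _ : Fin n => μ).real
      {x | n * δ ≤ |∑ i, A.indicator (fun _ => (1 : ℝ)) (x i) - n * μ.real A|}
      ≤ 1 / (4 * δ ^ 2) / n := by
  set X : S → ℝ := A.indicator fun _ => 1 with hX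
  have hXm : Measurable X := measurable_const.indicator hA
  have hXb : ∀ᵐ s ∂μ, X s ∈ Set.Icc (0 : ℝ) 1 := .of_forall fun s => by
    by_cases hs : s ∈ A <;> simp [hX, hs]
  have hXL : MemLp X 2 μ := memLp_of_bounded hXb hXm.aestronglyMeasurable 2
  have hXLi (i : Fin n) : MemLp (fun x : Fin n → S => X (x i)) 2 (Measure.pi fun _ => μ) :=
    hXL.comp_measurePreserving (measurePreserving_eval _ i)
  have hmean : ∫ x : Fin n → S, (∑ i, fun x : Fin n → S => X (x i)) x ∂(Measure.pi fun _ => μ)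
      = n * μ.real A := by
    simp only [Finset.sum_apply]
    rw [integral_finsetSum _ fun i _ => (hXLi i).integrable (by norm_num)]
    have hi (i : Fin n) : ∫ x : Fin n → S, X (x i) ∂(Measure.pi fun _ => μ) = μ.real A := by
      rw [integral_comp_eval (μ := fun _ : Fin n => μ) hXm.aestronglyMeasurable, hX,
        integral_indicator_const _ hA]
      simp
    simp [hi]
  have hvar : ProbabilityTheory.variance (∑ i, fun x : Fin n → S => X (x i))
      (Measure.pi fun _ => μ) ≤ n * (1 / 4) := by
    rw [ProbabilityTheory.variance_sum_pi (X := fun _ => X) fun _ => hXL]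
    have h4 := ProbabilityTheory.variance_le_sq_of_bounded hXb hXm.aemeasurable
    simp only [Finset.sum_const, Finset.card_univ, Fintype.card_fin, nsmul_eq_mul]
    gcongr
    linarith
  have hn' : (0 : ℝ) < n := by exact_mod_cast hn
  have hcheb := ProbabilityTheory.meas_ge_le_variance_div_sq
    (memLp_finsetSum' Finset.univ fun i _ => hXLi i) (mul_pos hn' hδ)
  rw [hmean] at hcheb
  simp only [Finset.sum_apply] at hcheb
  calc _ ≤ _ := ENNReal.toReal_le_of_le_ofReal
        (div_nonneg (ProbabilityTheory.variance_nonneg _ _) (sq_nonneg _)) hcheb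
    _ ≤ n * (1 / 4) / (n * δ) ^ 2 := by gcongr
    _ = 1 / (4 * δ ^ 2) / n := by field_simp

lemma measureReal_sub_le_one {S : Type*} [MeasurableSpace S] (m h : Measure S)
    [IsProbabilityMeasure m] (B : Set S) : (m B).toReal - (h B).toReal ≤ 1 := by
  have hm : (m B).toReal ≤ 1 := measureReal_le_one
  have hh : 0 ≤ (h B).toReal := ENNReal.toReal_nonneg
  linarith

lemma TVdist_le_one {S : Type*} [MeasurableSpace S] (m h : Measure S)
    [IsProbabilityMeasure m] : TVdist m h ≤ 1 :=
  haveI : Nonempty {B : Set S // MeasurableSet B} := ⟨∅, .empty⟩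
  ciSup_le fun B => measureReal_sub_le_one m h B.1

lemma sub_le_TVdist {S : Type*} [MeasurableSpace S] (m h : Measure S)
    [IsProbabilityMeasure m] {B : Set S} (hB : MeasurableSet B) :
    m.real B - h.real B ≤ TVdist m h :=
  le_ciSup (f := fun B : {B : Set S // MeasurableSet B} => (m B.1).toReal - (h B.1).toReal)
    ⟨1, Set.forall_mem_range.2 fun B => measureReal_sub_le_one m h B.1⟩ ⟨B, hB⟩

/-- The test `|#{i | x i ∈ A} - n * m A| < n * δ` separates the product measures. -/
lemma one_sub_le_TVdist_pi {S : Type*} [MeasurableSpace S] (m h : Measure S)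
    [IsProbabilityMeasure m] [IsProbabilityMeasure h] {A : Set S} (hA : MeasurableSet A)
    {δ : ℝ} (hδ : 0 < δ) (hsep : 2 * δ ≤ |m.real A - h.real A|) {n : ℕ} (hn : 0 < n) :
    1 - 2 * (1 / (4 * δ ^ 2) / n) ≤
      TVdist (Measure.pi fun _ : Fin n => m) (Measure.pi fun _ : Fin n => h) := by
  set f : (Fin n → S) → ℝ := fun x => ∑ i, A.indicator (fun _ => (1 : ℝ)) (x i)
  have hf : Measurable f := Finset.measurable_sum _ fun i _ =>
    (measurable_const.indicator hA).comp (measurable_pi_apply i)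
  have hC : MeasurableSet {x | n * δ ≤ |f x - n * m.real A|} :=
    measurableSet_le measurable_const (by fun_prop)
  have hm := measureReal_pi_abs_sum_indicator_sub_ge_le m hA hn hδ
  have hh := measureReal_pi_abs_sum_indicator_sub_ge_le h hA hn hδ
  have hsub : {x | n * δ ≤ |f x - n * m.real A|}ᶜ ⊆ {x | n * δ ≤ |f x - n * h.real A|} := by
    intro x hx
    simp only [Set.mem_compl_iff, Set.mem_ofPred_eq, not_le] at hx ⊢
    have hmul : n * (2 * δ) ≤ |n * m.real A - n * h.real A| := by
      rw [← mul_sub, abs_mul, Nat.abs_cast]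
      gcongr
    have htri := abs_sub_le (n * m.real A) (f x) (n * h.real A)
    rw [abs_sub_comm (n * m.real A) (f x)] at htri
    linarith
  have hle := (measureReal_mono hsub).trans hh
  have hTV := sub_le_TVdist (Measure.pi fun _ : Fin n => m) (Measure.pi fun _ : Fin n => h)
    hC.compl
  rw [probReal_compl_eq_one_sub hC] at hTV
  linarith

/-- If `m ≠ h` then the total variation between the `n`-fold product measures
tends to `1` as `n → ∞`. -/
theorem tv_product_tendsto_one {S : Type*} [MeasurableSpace S]
    (m h : Measure S) [IsProbabilityMeasure m] [IsProbabilityMeasure h]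
    (hmh : m ≠ h) :
    Tendsto
      (fun n : ℕ =>
        TVdist (Measure.pi fun _ : Fin n => m) (Measure.pi fun _ : Fin n => h))
      atTop (nhds 1) := by
  obtain ⟨A, hA, hne⟩ : ∃ A, MeasurableSet A ∧ m A ≠ h A := by
    by_contra! hall
    exact hmh (Measure.ext hall)
  have hpos : 0 < |m.real A - h.real A| := by
    rw [abs_pos, sub_ne_zero]
    exact fun heq => hne ((measureReal_eq_measureReal_iff).1 heq)
  have hlim : Tendsto (fun n : ℕ => 1 - 2 * (1 / (4 * (|m.real A - h.real A| / 2) ^ 2) / (n : ℝ)))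
      atTop (nhds 1) := by
    have hlim₀ := ((tendsto_const_div_atTop_nhds_zero_nat
      (1 / (4 * (|m.real A - h.real A| / 2) ^ 2))).const_mul 2).const_sub 1
    rwa [mul_zero, sub_zero] at hlim₀
  refine tendsto_of_tendsto_of_tendsto_of_le_of_le' hlim tendsto_const_nhds ?_
    (.of_forall fun n => TVdist_le_one _ _)
  filter_upwards [eventually_gt_atTop 0] with n hn
  exact one_sub_le_TVdist_pi m h hA (half_pos hpos) (by linarith) hn
end

section
/- Let S be a measurable space, let m and h be probability measures on S, and set δ = TV(m, h). Then for every natural number n there exists a measurable set A ⊆ S^n such that m^⊗n(Aᶜ) + h^⊗n(A) ≤ 2·exp(−n·δ²/2); that is, there is a detector on n i.i.d. samples whose sum of Type-II and Type-I error probabilities is at most 2·exp(−n·δ²/2). -/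
open MeasureTheory

open ProbabilityTheory

/-- The total variation distance is attained on the positive set of a Hahn decomposition. -/
lemma exists_measurableSet_TVdist_eq {S : Type*} [MeasurableSpace S]
    (m h : Measure S) [IsFiniteMeasure m] [IsFiniteMeasure h] :
    ∃ s, MeasurableSet s ∧ TVdist m h = m.real s - h.real s ∧ h.real s ≤ m.real s := by
  obtain ⟨s, hs, hpos, hneg⟩ := hahn_decomposition m h
  have hpos' (t : Set S) (ht : MeasurableSet t) (hts : t ⊆ s) : h.real t ≤ m.real t :=
    ENNReal.toReal_mono (measure_ne_top _ _) (hpos t ht hts)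
  have hneg' (t : Set S) (ht : MeasurableSet t) (hts : t ⊆ sᶜ) : m.real t ≤ h.real t :=
    ENNReal.toReal_mono (measure_ne_top _ _) (hneg t ht hts)
  have hmax (B : Set S) (hB : MeasurableSet B) :
      m.real B - h.real B ≤ m.real s - h.real s := by
    have h1 := hneg' (B \ s) (hB.diff hs) fun x hx => hx.2
    have h2 := hpos' (s \ B) (hs.diff hB) fun x hx => hx.1
    have e1 := measureReal_inter_add_sdiff (μ := m) (s := B) hs
    have e2 := measureReal_inter_add_sdiff (μ := h) (s := B) hs
    have e3 := measureReal_inter_add_sdiff (μ := m) (s := s) hB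
    have e4 := measureReal_inter_add_sdiff (μ := h) (s := s) hB
    rw [Set.inter_comm] at e3 e4
    linarith
  refine ⟨s, hs, ?_, hpos' s hs subset_rfl⟩
  have hgreatest : IsGreatest (Set.range fun B : {B : Set S // MeasurableSet B} =>
      (m B.1).toReal - (h B.1).toReal) (m.real s - h.real s) := by
    refine ⟨⟨⟨s, hs⟩, rfl⟩, ?_⟩
    rintro _ ⟨B, rfl⟩
    exact hmax B.1 B.2
  exact hgreatest.csSup_eq

/-- Hoeffding's inequality for the number of samples falling in a measurable set. -/
lemma pi_real_le_sum_indicator_le {S : Type*} [MeasurableSpace S]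
    (μ : Measure S) [IsProbabilityMeasure μ] (n : ℕ) {s : Set S} (hs : MeasurableSet s)
    {ε : ℝ} (hε : 0 ≤ ε) :
    (Measure.pi fun _ : Fin n => μ).real
        {x | n * ε ≤ ∑ i, (s.indicator (fun _ => (1 : ℝ)) (x i) - μ.real s)}
      ≤ Real.exp (-2 * n * ε ^ 2) := by
  set g : S → ℝ := fun y => s.indicator (fun _ => (1 : ℝ)) y - μ.real s
  have hind : Measurable (s.indicator fun _ => (1 : ℝ)) := measurable_const.indicator hs
  have hg : Measurable g := hind.sub_const _
  have hsub : HasSubgaussianMGF g (1 / 4) μ := by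
    have := hasSubgaussianMGF_of_mem_Icc (μ := μ) (a := 0) (b := 1) hind.aemeasurable
      (Filter.Eventually.of_forall fun y =>
        ⟨Set.indicator_nonneg (fun _ _ => zero_le_one) y,
          Set.indicator_le_self' (fun _ _ => zero_le_one) y⟩)
    rw [integral_indicator_const _ hs] at this
    convert this using 1
    · simp [g]
    · ext; norm_num
  have hpi (i : Fin n) :
      HasSubgaussianMGF (fun x : Fin n → S => g (x i)) (1 / 4) (Measure.pi fun _ => μ) := by
    refine HasSubgaussianMGF.of_map (X := g) (Y := fun x : Fin n → S => x i)
      (measurable_pi_apply i).aemeasurable ?_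
    rwa [(measurePreserving_eval (fun _ : Fin n => μ) i).map_eq]
  have key := HasSubgaussianMGF.measure_sum_ge_le_of_iIndepFun
    (iIndepFun_pi (μ := fun _ : Fin n => μ) (X := fun _ => g) fun _ => hg.aemeasurable)
    (s := Finset.univ) (fun i _ => hpi i) (ε := n * ε) (by positivity)
  refine key.trans_eq ?_
  congr 1
  rcases eq_or_ne n 0 with rfl | hn
  · simp
  · simp
    field_simp
    norm_num

/-- With `δ = TV(m, h)`, for every `n` there is a detector (acceptance region)
on `n` i.i.d. samples whose sum of Type-II and Type-I error probabilities is at most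
`2·exp(−n·δ²/2)`. -/
theorem exists_good_detector {S : Type*} [MeasurableSpace S]
    (m h : Measure S) [IsProbabilityMeasure m] [IsProbabilityMeasure h] (n : ℕ) :
    ∃ A : Set (Fin n → S), MeasurableSet A ∧
      ((Measure.pi fun _ : Fin n => m) Aᶜ).toReal
        + ((Measure.pi fun _ : Fin n => h) A).toReal
        ≤ 2 * Real.exp (-(n : ℝ) * (TVdist m h) ^ 2 / 2) := by
  obtain ⟨s, hs, hTV, hle⟩ := exists_measurableSet_TVdist_eq m h
  have hε : 0 ≤ (m.real s - h.real s) / 2 := by linarith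
  have hm := pi_real_le_sum_indicator_le m n hs.compl hε
  have hh := pi_real_le_sum_indicator_le h n hs hε
  have hexp : -2 * (n : ℝ) * ((m.real s - h.real s) / 2) ^ 2
      = -(n : ℝ) * (TVdist m h) ^ 2 / 2 := by rw [hTV]; ring
  rw [hexp] at hm hh
  refine ⟨{x | n * ((m.real s - h.real s) / 2)
    ≤ ∑ i, (s.indicator (fun _ => (1 : ℝ)) (x i) - h.real s)}, ?_, ?_⟩
  · refine measurableSet_le measurable_const (Finset.measurable_sum _ fun i _ => ?_)
    exact ((measurable_const.indicator hs).comp (measurable_pi_apply i)).sub_const _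
  · rw [two_mul]
    refine add_le_add (le_trans (measureReal_mono fun x hx => ?_) hm) hh
    simp only [Set.mem_compl_iff, Set.mem_ofPred_eq, not_le] at hx ⊢
    simp only [Set.indicator_compl, Pi.sub_apply, probReal_compl_eq_one_sub hs,
      Finset.sum_sub_distrib, Finset.sum_const, Finset.card_univ, Fintype.card_fin,
      nsmul_eq_mul] at hx ⊢
    linarith
end

section
/- Let S be a measurable space, let m and h be probability measures on S, let n be a natural number, and let D : S^n → ℝ be any measurable detector. Let X ~ m^⊗n and Y ~ h^⊗n be independent (i.e., consider the product measure m^⊗n ⊗ h^⊗n on S^n × S^n). Then the AUROC of D, defined as P(D(X) > D(Y)) + (1/2)·P(D(X) = D(Y)), satisfies AUROC ≤ 1/2 + T − T²/2, where T = TV(m^⊗n, h^⊗n). (Proposition: area under the ROC curve bound for detection from n i.i.d. samples.) -/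
open MeasureTheory

section TotalVariation

variable {Ω : Type*} [MeasurableSpace Ω]

lemma measureReal_sub_le_TVdist (P Q : Measure Ω) [IsProbabilityMeasure P]
    {B : Set Ω} (hB : MeasurableSet B) : P.real B - Q.real B ≤ TVdist P Q := by
  refine le_ciSup (f := fun B : {B : Set Ω // MeasurableSet B} ↦ (P B.1).toReal - (Q B.1).toReal)
    ⟨1, ?_⟩ ⟨B, hB⟩
  rintro _ ⟨A, rfl⟩
  have h₁ : P.real A.1 ≤ 1 := measureReal_le_one
  have h₂ : 0 ≤ Q.real A.1 := measureReal_nonneg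
  simp only [Measure.real] at h₁ h₂
  linarith

lemma TVdist_le_one_s9 (P Q : Measure Ω) [IsProbabilityMeasure P] : TVdist P Q ≤ 1 := by
  have : Nonempty {B : Set Ω // MeasurableSet B} := ⟨⟨∅, MeasurableSet.empty⟩⟩
  refine ciSup_le fun B ↦ ?_
  have h₁ : P.real B.1 ≤ 1 := measureReal_le_one
  have h₂ : 0 ≤ Q.real B.1 := measureReal_nonneg
  simp only [Measure.real] at h₁ h₂
  linarith

/-- Two probability measures share a common part of mass at least `1 - TVdist P Q`. -/
lemma exists_le_le_one_sub_TVdist_le (P Q : Measure Ω)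
    [IsProbabilityMeasure P] [IsProbabilityMeasure Q] :
    ∃ C : Measure Ω, C ≤ P ∧ C ≤ Q ∧ 1 - TVdist P Q ≤ C.real Set.univ := by
  obtain ⟨s, hs⟩ := exists_isHahnDecomposition P Q
  have hm := hs.measurableSet
  refine ⟨P.restrict s + Q.restrict sᶜ, ?_, ?_, ?_⟩
  · calc P.restrict s + Q.restrict sᶜ ≤ P.restrict s + P.restrict sᶜ := by
          exact add_le_add_right hs.ge_on_compl _
      _ = P := Measure.restrict_add_restrict_compl hm
  · calc P.restrict s + Q.restrict sᶜ ≤ Q.restrict s + Q.restrict sᶜ := by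
          exact add_le_add_left hs.le_on _
      _ = Q := Measure.restrict_add_restrict_compl hm
  · have h := measureReal_sub_le_TVdist P Q hm.compl
    rw [measureReal_compl hm, probReal_univ] at h
    rw [measureReal_add_apply, measureReal_restrict_apply_univ, measureReal_restrict_apply_univ]
    linarith

lemma measureReal_gt_add_eq_add_lt (P Q : Measure Ω) [IsFiniteMeasure P] [IsFiniteMeasure Q]
    {D : Ω → ℝ} (hD : Measurable D) :
    (P.prod Q).real {p | D p.2 < D p.1} + (P.prod Q).real {p | D p.1 = D p.2} +
      (P.prod Q).real {p | D p.1 < D p.2} = (P.prod Q).real Set.univ := by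
  have h₁ : MeasurableSet {p : Ω × Ω | D p.1 < D p.2} :=
    measurableSet_lt (hD.comp measurable_fst) (hD.comp measurable_snd)
  have h₂ : MeasurableSet {p : Ω × Ω | D p.1 = D p.2} :=
    measurableSet_eq_fun (hD.comp measurable_fst) (hD.comp measurable_snd)
  rw [← measureReal_union _ h₂, ← measureReal_union _ h₁]
  · congr 1
    ext p
    rcases lt_trichotomy (D p.1) (D p.2) with h | h | h <;> simp [h]
  · refine Set.disjoint_left.2 fun p h₃ h₄ ↦ ?_
    simp only [Set.mem_union, Set.mem_ofPred_eq] at h₃ h₄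
    rcases h₃ with h₃ | h₃ <;> linarith
  · exact Set.disjoint_left.2 fun p h₃ h₄ ↦ (ne_of_lt h₃) h₄.symm

lemma sq_measureReal_univ_eq_two_mul_lt_add_eq (C : Measure Ω) [IsFiniteMeasure C]
    {D : Ω → ℝ} (hD : Measurable D) :
    C.real Set.univ ^ 2 =
      2 * (C.prod C).real {p | D p.1 < D p.2} + (C.prod C).real {p | D p.1 = D p.2} := by
  have h₁ : MeasurableSet {p : Ω × Ω | D p.1 < D p.2} :=
    measurableSet_lt (hD.comp measurable_fst) (hD.comp measurable_snd)
  have hswap : (C.prod C).real {p | D p.2 < D p.1} = (C.prod C).real {p | D p.1 < D p.2} := by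
    conv_rhs => rw [← Measure.prod_swap]
    rw [map_measureReal_apply measurable_swap h₁]
    rfl
  rw [sq, ← measureReal_prod_prod, Set.univ_prod_univ, ← measureReal_gt_add_eq_add_lt C C hD, hswap]
  ring

/-- The AUROC bound for a detector separating two arbitrary probability measures. -/
lemma auroc_le (P Q : Measure Ω) [IsProbabilityMeasure P] [IsProbabilityMeasure Q]
    {D : Ω → ℝ} (hD : Measurable D) :
    (P.prod Q).real {p | D p.2 < D p.1} + 1 / 2 * (P.prod Q).real {p | D p.1 = D p.2} ≤
      1 / 2 + TVdist P Q - TVdist P Q ^ 2 / 2 := by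
  obtain ⟨C, hCP, hCQ, hC⟩ := exists_le_le_one_sub_TVdist_le P Q
  have : IsFiniteMeasure C := isFiniteMeasure_of_le P hCP
  have hle : C.prod C ≤ P.prod Q := Measure.prod_mono hCP hCQ
  have hmono (A : Set (Ω × Ω)) : (C.prod C).real A ≤ (P.prod Q).real A :=
    ENNReal.toReal_mono (measure_ne_top _ _) (hle A)
  have hsum := measureReal_gt_add_eq_add_lt P Q hD
  rw [probReal_univ] at hsum
  have hsq := sq_measureReal_univ_eq_two_mul_lt_add_eq C hD
  have hbound : (1 - TVdist P Q) ^ 2 ≤ C.real Set.univ ^ 2 :=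
    pow_le_pow_left₀ (sub_nonneg.2 (TVdist_le_one_s9 P Q)) hC 2
  have hlt := hmono {p | D p.1 < D p.2}
  have heq := hmono {p | D p.1 = D p.2}
  linarith

end TotalVariation

/-- Area under the ROC curve bound: for any measurable detector `D` on `n` i.i.d.
samples, with `X ~ m^⊗n` and `Y ~ h^⊗n` independent, the AUROC
`P(D X > D Y) + (1/2)·P(D X = D Y)` is at most `1/2 + T − T²/2`
where `T = TV(m^⊗n, h^⊗n)`. -/
theorem auroc_upper_bound {S : Type*} [MeasurableSpace S]
    (m h : Measure S) [IsProbabilityMeasure m] [IsProbabilityMeasure h]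
    (n : ℕ) (D : (Fin n → S) → ℝ) (hD : Measurable D) :
    (((Measure.pi fun _ : Fin n => m).prod (Measure.pi fun _ : Fin n => h))
        {p | D p.2 < D p.1}).toReal
      + (1 / 2) *
        (((Measure.pi fun _ : Fin n => m).prod (Measure.pi fun _ : Fin n => h))
          {p | D p.1 = D p.2}).toReal
      ≤ 1 / 2
        + TVdist (Measure.pi fun _ : Fin n => m) (Measure.pi fun _ : Fin n => h)
        - (TVdist (Measure.pi fun _ : Fin n => m) (Measure.pi fun _ : Fin n => h)) ^ 2 / 2 := by
  exact auroc_le _ _ hD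
end

section
/- Let δ > 0, α ≥ 0 be real numbers and ε ∈ [1/2, 1); set γ = log(8/(1 − ε)). If a real number n > 0 satisfies n ≥ γ/(2δ²) + 2α/δ + √(γ² + 8αδγ)/(2δ²), then, with T := 1 − 4·exp(−2·(n·δ/2 − α)²/n), one has 1/2 + T − T²/2 ≥ ε. (Analytic core of the non-i.i.d. sample complexity theorem: if the total variation between the n-sample machine and human distributions is at least 1 − 4·exp(−2(nδ/2 − α)²/n), then the best detector's AUROC 1/2 + T − T²/2 reaches level ε once n exceeds the stated bound.) -/
/-- Beyond the larger root of `δ² n² - (γ + 4αδ) n + 4α²` this quadratic in `n` is nonnegative. -/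
lemma mul_le_sq_sub_of_root_le {δ α γ n : ℝ} (hδ : 0 < δ) (hα : 0 ≤ α) (hγ : 0 ≤ γ)
    (hn : γ / (2 * δ ^ 2) + 2 * α / δ + √(γ ^ 2 + 8 * α * δ * γ) / (2 * δ ^ 2) ≤ n) :
    γ * n ≤ (n * δ - 2 * α) ^ 2 := by
  have hroot : √(γ ^ 2 + 8 * α * δ * γ) ≤ 2 * δ ^ 2 * n - γ - 4 * α * δ := by
    have h := mul_le_mul_of_nonneg_left hn (by positivity : 0 ≤ 2 * δ ^ 2)
    have e : 2 * δ ^ 2 * (γ / (2 * δ ^ 2) + 2 * α / δ + √(γ ^ 2 + 8 * α * δ * γ) / (2 * δ ^ 2))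
        = γ + 4 * α * δ + √(γ ^ 2 + 8 * α * δ * γ) := by
      field_simp
      ring
    linarith
  have hsq := pow_le_pow_left₀ (Real.sqrt_nonneg _) hroot 2
  rw [Real.sq_sqrt (by positivity)] at hsq
  refine le_of_mul_le_mul_left ?_ (by positivity : 0 < 4 * δ ^ 2)
  linarith

/-- Analytic core of the non-i.i.d. sample complexity theorem: with
`γ = log(8/(1 − ε))`, if `n ≥ γ/(2δ²) + 2α/δ + √(γ² + 8αδγ)/(2δ²)` and `n > 0`,
then with `T = 1 − 4·exp(−2·(nδ/2 − α)²/n)` one has `1/2 + T − T²/2 ≥ ε`. -/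
theorem noniid_sample_complexity_core (δ α ε n : ℝ) (hδ : 0 < δ) (hα : 0 ≤ α)
    (hε : ε ∈ Set.Ico (1 / 2 : ℝ) 1) (hn0 : 0 < n)
    (hn : n ≥ Real.log (8 / (1 - ε)) / (2 * δ ^ 2) + 2 * α / δ
        + Real.sqrt ((Real.log (8 / (1 - ε))) ^ 2
            + 8 * α * δ * Real.log (8 / (1 - ε))) / (2 * δ ^ 2)) :
    1 / 2 + (1 - 4 * Real.exp (-2 * (n * δ / 2 - α) ^ 2 / n))
      - (1 - 4 * Real.exp (-2 * (n * δ / 2 - α) ^ 2 / n)) ^ 2 / 2 ≥ ε := by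
  obtain ⟨hε₁, hε₂⟩ := hε
  have hpos : 0 < 1 - ε := by linarith
  have hγ : 0 ≤ Real.log (8 / (1 - ε)) :=
    Real.log_nonneg ((one_le_div hpos).2 (by linarith))
  have hquad := mul_le_sq_sub_of_root_le hδ hα hγ hn
  have hexp : Real.exp (-2 * (n * δ / 2 - α) ^ 2 / n) ^ 2 ≤ (1 - ε) / 8 := by
    rw [← Real.exp_nat_mul, ← Real.le_log_iff_exp_le (by positivity), ← inv_div 8 (1 - ε),
      Real.log_inv]
    have e : ((2 : ℕ) : ℝ) * (-2 * (n * δ / 2 - α) ^ 2 / n) = -((n * δ - 2 * α) ^ 2 / n) := by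
      push_cast
      ring
    rw [e]
    exact neg_le_neg ((le_div_iff₀ hn0).2 hquad)
  linarith
end
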